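/- For q ∈ ℕ, gc(PM_q) = q if and only if there exists a Hadamard matrix of order q. -/

import Mathlib

open Matrix

def GCFeasible {V : Type*} [Fintype V] (A : Matrix V V ℝ) (m : ℕ) : Prop :=
  ∃ (k : ℕ) (P : Matrix (Fin k) V ℝ) (w : Fin k → ℝ),
    (∀ p i, P p i = 1 ∨ P p i = -1) ∧
    (∀ i, A i i = 0) ∧
    (∀ i j, i ≠ j → A i j = (Pᵀ * Matrix.diagonal w * P) i j) ∧
    m = (Finset.univ.filter fun p => w p ≠ 0).card

noncomputable def gc {V : Type*} [Fintype V] (A : Matrix V V ℝ) : ℕ :=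
  sInf { m | GCFeasible A m }

open scoped Classical in
noncomputable def gcGraph {V : Type*} [Fintype V] (G : SimpleGraph V) : ℕ :=
  gc (Matrix.of fun u v => if G.Adj u v then (1 : ℝ) else 0)

/-- The perfect matching graph PM_q on 2q vertices: vertex 2i is matched to 2i+1. -/
def perfectMatchingGraph (q : ℕ) : SimpleGraph (Fin (2 * q)) :=
  SimpleGraph.fromRel fun u v => u.val / 2 = v.val / 2

theorem transpose_mul_diagonal_mul_apply {κ m n : Type*} [Fintype κ] [DecidableEq κ]
    (C : Matrix κ m ℝ) (w : κ → ℝ) (D : Matrix κ n ℝ) (i : m) (j : n) :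
    (Cᵀ * diagonal w * D) i j = ∑ p, C p i * w p * D p j := by
  rw [mul_apply]
  simp only [mul_diagonal, transpose_apply]

/-- Discarding the zero weights, a feasible size is realised by nonvanishing weights. -/
theorem GCFeasible.exists_weights_ne_zero {V : Type*} [Fintype V] {A : Matrix V V ℝ} {m : ℕ}
    (h : GCFeasible A m) :
    ∃ (P : Matrix (Fin m) V ℝ) (w : Fin m → ℝ),
      (∀ p i, P p i = 1 ∨ P p i = -1) ∧ (∀ p, w p ≠ 0) ∧
      ∀ i j, i ≠ j → A i j = ∑ p, P p i * w p * P p j := by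
  obtain ⟨k, P, w, hP, -, hA, hm⟩ := h
  have hcard : Fintype.card {p // w p ≠ 0} = m := by rw [hm, Fintype.card_subtype]
  let e : Fin m ≃ {p // w p ≠ 0} := (Fintype.equivFinOfCardEq hcard).symm
  refine ⟨fun p => P (e p), fun p => w (e p), fun p => hP _, fun p => (e p).2, fun i j hij => ?_⟩
  rw [hA i j hij, Equiv.sum_comp e (fun p => P p i * w p * P p j),
    transpose_mul_diagonal_mul_apply]
  rw [← Finset.sum_subtype (Finset.univ.filter fun p => w p ≠ 0) (by simp)
    (fun p => P p i * w p * P p j)]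
  exact (Finset.sum_filter_of_ne fun p _ hp =>
    right_ne_zero_of_mul (left_ne_zero_of_mul hp)).symm

theorem perfectMatchingGraph_adj {q : ℕ} {u v : Fin (2 * q)} :
    (perfectMatchingGraph q).Adj u v ↔ u ≠ v ∧ u.val / 2 = v.val / 2 := by
  simp only [perfectMatchingGraph, SimpleGraph.fromRel_adj, eq_comm (a := v.val / 2), or_self]

/-- A weighted sign factorisation of a perfect matching restricts to its even and odd vertices. -/
theorem GCFeasible.exists_even_odd_factors {q m : ℕ} {A : Matrix (Fin (2 * q)) (Fin (2 * q)) ℝ}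
    (hA : ∀ u v, u ≠ v → A u v = if u.val / 2 = v.val / 2 then 1 else 0)
    (h : GCFeasible A m) :
    ∃ (C D : Matrix (Fin m) (Fin q) ℝ) (w : Fin m → ℝ),
      (∀ p i, C p i = 1 ∨ C p i = -1) ∧ (∀ p, w p ≠ 0) ∧
      Cᵀ * diagonal w * D = 1 ∧ Cᵀ * diagonal w * C = (∑ p, w p) • 1 := by
  obtain ⟨P, w, hP, hw, hAP⟩ := h.exists_weights_ne_zero
  refine ⟨P.submatrix id fun i : Fin q => ⟨2 * i, by omega⟩,
    P.submatrix id fun i : Fin q => ⟨2 * i + 1, by omega⟩, w, fun p i => hP _ _, hw, ?_, ?_⟩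
  · ext i j
    have hne : (⟨2 * i, by omega⟩ : Fin (2 * q)) ≠ ⟨2 * j + 1, by omega⟩ := by
      simp only [ne_eq, Fin.mk.injEq]; omega
    rw [transpose_mul_diagonal_mul_apply, one_apply]
    simp only [submatrix_apply, id]
    rw [← hAP _ _ hne, hA _ _ hne]
    congr 1
    simp only [Fin.ext_iff, eq_iff_iff]
    omega
  · ext i j
    rw [transpose_mul_diagonal_mul_apply, Matrix.smul_apply, one_apply, smul_eq_mul]
    simp only [submatrix_apply, id]
    by_cases hij : i = j
    · subst hij
      rw [if_pos rfl, mul_one]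
      refine Finset.sum_congr rfl fun p _ => ?_
      rcases hP p ⟨2 * i, by omega⟩ with h | h <;> rw [h] <;> ring
    · have hne : (⟨2 * i, by omega⟩ : Fin (2 * q)) ≠ ⟨2 * j, by omega⟩ := by
        simp only [ne_eq, Fin.mk.injEq]; omega
      rw [← hAP _ _ hne, hA _ _ hne, if_neg hij, if_neg (by dsimp only; omega), mul_zero]

theorem le_of_mul_diagonal_mul_eq_one {q m : ℕ} {C D : Matrix (Fin m) (Fin q) ℝ} {w : Fin m → ℝ}
    (h : Cᵀ * diagonal w * D = 1) : q ≤ m := by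
  have h₁ : (1 : Matrix (Fin q) (Fin q) ℝ).rank ≤ m :=
    h ▸ (rank_mul_le_right _ _).trans ((rank_le_card_height D).trans_eq (Fintype.card_fin m))
  simpa using h₁

theorem mul_transpose_eq_of_factors {q : ℕ} {C D : Matrix (Fin q) (Fin q) ℝ} {w : Fin q → ℝ}
    (hC : ∀ p i, C p i = 1 ∨ C p i = -1) (hw : ∀ p, w p ≠ 0)
    (hCD : Cᵀ * diagonal w * D = 1) {t : ℝ} (hCC : Cᵀ * diagonal w * C = t • 1) :
    C * Cᵀ = (q : ℝ) • (1 : Matrix (Fin q) (Fin q) ℝ) := by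
  have hCtD : C = t • D := by
    calc C = D * (Cᵀ * diagonal w) * C := by rw [mul_eq_one_comm.mp hCD, one_mul]
      _ = t • D := by rw [Matrix.mul_assoc, hCC, Matrix.mul_smul, Matrix.mul_one]
  have hswap : C * Cᵀ * diagonal w = t • 1 := by
    rw [Matrix.mul_assoc]
    nth_rewrite 1 [hCtD]
    rw [Matrix.smul_mul, mul_eq_one_comm.mp hCD]
  ext i j
  by_cases hij : i = j
  · subst hij
    have hsq : ∀ x, C i x * C i x = 1 := fun x => by
      rcases hC i x with h | h <;> rw [h] <;> norm_num
    simp [mul_apply, hsq]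
  · have := congrFun (congrFun hswap i) j
    rw [mul_diagonal] at this
    simpa [hij, hw j] using this

/-- Duplicating the columns of a Hadamard matrix yields a coupling of the perfect matching. -/
theorem gcFeasible_of_hadamard {q : ℕ} {A : Matrix (Fin (2 * q)) (Fin (2 * q)) ℝ}
    (hA₀ : ∀ u, A u u = 0)
    (hA : ∀ u v, u ≠ v → A u v = if u.val / 2 = v.val / 2 then 1 else 0)
    {H : Matrix (Fin q) (Fin q) ℝ} (hH : ∀ i j, H i j = 1 ∨ H i j = -1)
    (hHH : H * Hᵀ = (q : ℝ) • (1 : Matrix (Fin q) (Fin q) ℝ)) : GCFeasible A q := by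
  refine ⟨q, H.submatrix id fun u : Fin (2 * q) => ⟨u / 2, by omega⟩, fun _ => (q : ℝ)⁻¹,
    fun p i => hH _ _, hA₀, fun u v huv => ?_, ?_⟩
  · have hq : (q : ℝ) ≠ 0 := by
      have := u.2
      exact Nat.cast_ne_zero.mpr (by omega)
    have hinv : H * ((q : ℝ)⁻¹ • Hᵀ) = 1 := by
      rw [Matrix.mul_smul, hHH, smul_smul, inv_mul_cancel₀ hq, one_smul]
    have hleft : ((q : ℝ)⁻¹ • Hᵀ) * H = 1 := mul_eq_one_comm.mp hinv
    have huv' := congrFun (congrFun hleft ⟨u / 2, by omega⟩) ⟨v / 2, by omega⟩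
    rw [hA u v huv]
    simp only [mul_apply, Matrix.smul_apply, transpose_apply, smul_eq_mul, one_apply,
      Fin.mk.injEq] at huv'
    rw [← huv', transpose_mul_diagonal_mul_apply]
    simp only [submatrix_apply, id]
    exact Finset.sum_congr rfl fun p _ => by ring
  · have : ∀ _ : Fin q, (q : ℝ)⁻¹ ≠ 0 := fun p =>
      inv_ne_zero (Nat.cast_ne_zero.mpr (by have := p.2; omega))
    rw [Finset.filter_true_of_mem fun p _ => this p, Finset.card_univ, Fintype.card_fin]

/-- Theorem: gc(PM_q) = q iff there exists a Hadamard matrix of order q. -/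
theorem pm_gc_eq_iff_hadamard (q : ℕ) :
    gcGraph (perfectMatchingGraph q) = q ↔
      ∃ H : Matrix (Fin q) (Fin q) ℝ,
        (∀ i j, H i j = 1 ∨ H i j = -1) ∧
        H * Hᵀ = (q : ℝ) • (1 : Matrix (Fin q) (Fin q) ℝ) := by
  classical
  rw [gcGraph, gc]
  set A : Matrix (Fin (2 * q)) (Fin (2 * q)) ℝ := Matrix.of fun u v =>
    if (perfectMatchingGraph q).Adj u v then (1 : ℝ) else 0 with hAdef
  have hA₀ : ∀ u, A u u = 0 := fun u => by simp [hAdef]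
  have hA : ∀ u v, u ≠ v → A u v = if u.val / 2 = v.val / 2 then 1 else 0 := fun u v huv => by
    simp [hAdef, perfectMatchingGraph_adj, huv]
  constructor
  · intro h
    rcases Nat.eq_zero_or_pos q with rfl | hq
    · exact ⟨1, fun i => i.elim0, Subsingleton.elim _ _⟩
    · have hmem : GCFeasible A q := by
        have := Nat.sInf_mem (Nat.nonempty_of_pos_sInf (hq.trans_eq h.symm))
        rwa [h] at this
      obtain ⟨C, D, w, hC, hw, hCD, hCC⟩ := hmem.exists_even_odd_factors hA
      exact ⟨C, hC, mul_transpose_eq_of_factors hC hw hCD hCC⟩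
  · rintro ⟨H, hH, hHH⟩
    have hmem := gcFeasible_of_hadamard hA₀ hA hH hHH
    refine le_antisymm (Nat.sInf_le hmem) (le_csInf ⟨q, hmem⟩ fun m hm => ?_)
    obtain ⟨C, D, w, -, -, hCD, -⟩ := GCFeasible.exists_even_odd_factors hA hm
    exact le_of_mul_diagonal_mul_eq_one hCD
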